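/- Let d ≥ 2 and for j ∈ {0,1} define q_j(t) = ∫_{−1/2}^{1/2} θ(x, t/2)/θ(x + j/2, t) dx for t > 0. For m ∈ ℤ^d \ {0}, let e(m) denote the number of even coordinates of m. Then U(m) = −(1/Γ((d+2)/2)) ∫₀^∞ t^{d/2} e^{−t} q₀(|m|²/(4t))^{e(m)} q₁(|m|²/(4t))^{d−e(m)} dt. In particular, U(m) depends only on |m| and e(m). -/

import Mathlib

open MeasureTheory Real Filter

noncomputable section

/-- The lattice ℤ^d. -/
abbrev ZLat (d : ℕ) := Fin d → ℤ

/-- Embedding of the lattice ℤ^d into Euclidean space ℝ^d. -/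
def latVec {d : ℕ} (m : ZLat d) : EuclideanSpace ℝ (Fin d) := WithLp.toLp 2 fun i => (m i : ℝ)

/-- The (Gaussian) heat kernel on ℝ^d. -/
def heatK (d : ℕ) (t : ℝ) (x : EuclideanSpace ℝ (Fin d)) : ℝ :=
  (2 * π * t) ^ (-(d : ℝ) / 2) * Real.exp (-‖x‖ ^ 2 / (2 * t))

/-- The periodic heat kernel H_t(x) = Σ_{n ∈ ℤ^d} P_t(x − n). -/
def pHeatK (d : ℕ) (t : ℝ) (x : EuclideanSpace ℝ (Fin d)) : ℝ :=
  ∑' n : ZLat d, heatK d t (x - latVec n)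

/-- Partial derivative in the j-th coordinate direction. -/
def pderiv {d : ℕ} (j : Fin d) (f : EuclideanSpace ℝ (Fin d) → ℝ)
    (x : EuclideanSpace ℝ (Fin d)) : ℝ :=
  fderiv ℝ f x (EuclideanSpace.single j 1)

/-- The constant c_d = π^{-d/2} Γ((d+2)/2). -/
def cConst (d : ℕ) : ℝ := π ^ (-(d : ℝ) / 2) * Real.Gamma (((d : ℝ) + 2) / 2)

/-- The discrete second-order Riesz kernel K_dis^{(jk)}. -/
def discK (d : ℕ) (j k : Fin d) (m : ZLat d) : ℝ :=
  if m = 0 then 0 else cConst d * (m j : ℝ) * (m k : ℝ) / ‖latVec m‖ ^ (d + 2)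

/-- The discrete second-order Riesz transform R_dis^{(jk)}. -/
def Rdis (d : ℕ) (j k : Fin d) (f : ZLat d → ℝ) (n : ZLat d) : ℝ :=
  ∑' m : ZLat d, discK d j k m * f (n - m)

/-- The probabilistic kernel 𝒦^{(jk)}(m). -/
def probK (d : ℕ) (j k : Fin d) (m : ZLat d) : ℝ :=
  -∫ s in Set.Ioi (0 : ℝ), ∫ x : EuclideanSpace ℝ (Fin d),
      pHeatK d s x *
        (pderiv j (fun y => heatK d s y / pHeatK d s y) x *
         pderiv k (fun y => heatK d s (y - latVec m) / pHeatK d s y) x)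

/-- The probabilistic discrete second-order Riesz transform 𝓡^{(jk)}. -/
def Rprob (d : ℕ) (j k : Fin d) (f : ZLat d → ℝ) (n : ZLat d) : ℝ :=
  ∑' m : ZLat d, probK d j k (n - m) * f m

/-- The ℓ^p norm of f : ℤ^d → ℝ. -/
def lpN (d : ℕ) (p : ℝ) (f : ZLat d → ℝ) : ℝ := (∑' n : ZLat d, |f n| ^ p) ^ (1 / p)

/-- Membership in ℓ^p(ℤ^d). -/
def MemLpLat (d : ℕ) (p : ℝ) (f : ZLat d → ℝ) : Prop := Summable fun n : ZLat d => |f n| ^ p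

/-- Operator norm of an operator on ℓ^p(ℤ^d): sup of ‖Tf‖ over ‖f‖ = 1. -/
def opN (d : ℕ) (p : ℝ) (T : (ZLat d → ℝ) → (ZLat d → ℝ)) : ℝ :=
  sSup {c : ℝ | ∃ f : ZLat d → ℝ, MemLpLat d p f ∧ lpN d p f = 1 ∧ c = lpN d p (T f)}

/-- p* = max{p, p/(p-1)}. -/
def pstar (p : ℝ) : ℝ := max p (p / (p - 1))


/-- The function U(x), extended to real arguments. -/
def Ufun (d : ℕ) (x : EuclideanSpace ℝ (Fin d)) : ℝ :=
  -(π ^ ((d : ℝ) / 2) * Real.Gamma (((d : ℝ) + 2) / 2))⁻¹ *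
    ∫ s in Set.Ioi (0 : ℝ), ∫ z : EuclideanSpace ℝ (Fin d),
      s ^ ((d : ℝ) / 2) * Real.exp (-s - ‖z‖ ^ 2) /
        pHeatK d (‖x‖ ^ 2 / (4 * s)) ((‖x‖ / (2 * Real.sqrt s)) • z + (2 : ℝ)⁻¹ • x)

/-- The Jacobi theta function θ(x,t) = Σ_{n ∈ ℤ} (2πt)^{-1/2} exp(-(x-n)²/(2t)). -/
def theta (x t : ℝ) : ℝ :=
  ∑' n : ℤ, (2 * π * t) ^ (-(1 : ℝ) / 2) * Real.exp (-(x - (n : ℝ)) ^ 2 / (2 * t))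

/-- q_j(t) = ∫_{-1/2}^{1/2} θ(x, t/2)/θ(x + j/2, t) dx. -/
def qfun (j : ℝ) (t : ℝ) : ℝ :=
  ∫ x in Set.Icc (-(1 : ℝ) / 2) (1 / 2), theta x (t / 2) / theta (x + j / 2) t

open Classical in
/-- Number of even coordinates of m ∈ ℤ^d. -/
def evenCount {d : ℕ} (m : ZLat d) : ℕ := (Finset.univ.filter fun i => Even (m i)).card

lemma hasSum_pi_prod_aux : ∀ (d : ℕ) (f : Fin d → ℤ → ℝ), (∀ i n, 0 ≤ f i n) →
    (∀ i, Summable (f i)) →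
    HasSum (fun n : Fin d → ℤ => ∏ i, f i (n i)) (∏ i, ∑' k, f i k) := by
  intro d
  induction d with
  | zero =>
    intro f _ _
    simp
  | succ d ih =>
    intro f h0 hs
    have h1 := ih (fun i => f i.succ) (fun i n => h0 _ _) (fun i => hs _)
    have h2 := (hs 0).hasSum
    have n1 : (0 : ℤ → ℝ) ≤ f 0 := fun n => h0 0 n
    have n2 : (0 : (Fin d → ℤ) → ℝ) ≤ fun n => ∏ i, f (Fin.succ i) (n i) :=
      fun n => Finset.prod_nonneg fun i _ => h0 _ _
    have hsm : Summable (fun p : ℤ × (Fin d → ℤ) => f 0 p.1 * ∏ i, f (Fin.succ i) (p.2 i)) :=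
      Summable.mul_of_nonneg (f := f 0) (g := fun n : Fin d → ℤ => ∏ i, f (Fin.succ i) (n i))
        (hs 0) h1.summable n1 n2
    have h3 := HasSum.mul (f := f 0) (g := fun n : Fin d → ℤ => ∏ i, f (Fin.succ i) (n i))
      h2 h1 hsm
    rw [← (Fin.consEquiv (fun _ : Fin (d+1) => ℤ)).hasSum_iff, Fin.prod_univ_succ]
    convert! h3 using 1
    funext p
    simp [Fin.consEquiv, Fin.prod_univ_succ]

lemma summable_theta_aux (x : ℝ) {t : ℝ} (ht : 0 < t) :
    Summable fun n : ℤ => (2 * π * t) ^ (-(1 : ℝ) / 2) * Real.exp (-(x - (n : ℝ)) ^ 2 / (2 * t)) := by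
  apply Summable.mul_left
  have hT : 0 < 1 / (2 * π * t) := by positivity
  refine Summable.of_nonneg_of_le (fun n => (Real.exp_pos _).le) (fun n => ?_)
    (summable_pow_mul_jacobiTheta₂_term_bound (|x| / (2 * π * t)) hT 0)
  rw [pow_zero, one_mul]
  apply Real.exp_le_exp.2
  have : -π * (1 / (2 * π * t) * (n:ℝ) ^ 2 - 2 * (|x| / (2 * π * t)) * |(n:ℝ)|)
      = (-(n:ℝ)^2 + 2 * (|x| * |(n:ℝ)|)) / (2 * t) := by
    field_simp
    ring
  push_cast
  rw [this]
  apply div_le_div_of_nonneg_right _ (by positivity)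
  have := le_abs_self (x * n)
  rw [abs_mul] at this
  nlinarith [sq_nonneg x]

lemma theta_lb {t : ℝ} (ht : 0 < t) : ∃ c > 0, ∀ x, c ≤ theta x t := by
  refine ⟨(2 * π * t) ^ (-(1 : ℝ) / 2) * Real.exp (-(1/4) / (2 * t)), by positivity, fun x => ?_⟩
  refine le_trans ?_ ((summable_theta_aux x ht).le_tsum (round x) (fun n _ => by positivity))
  have h : (x - round x) ^ 2 ≤ 1/4 := by
    have := abs_sub_round x
    rw [← sq_abs]
    nlinarith [abs_nonneg (x - round x)]
  gcongr

lemma theta_pos (x : ℝ) {t : ℝ} (ht : 0 < t) : 0 < theta x t := by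
  obtain ⟨c, hc, h⟩ := theta_lb ht
  exact hc.trans_le (h x)

lemma theta_add_int (x t : ℝ) (k : ℤ) : theta (x + k) t = theta x t := by
  unfold theta
  rw [← (Equiv.addRight k).tsum_eq]
  refine tsum_congr fun n => ?_
  simp

lemma measurable_theta (t : ℝ) : Measurable fun x => theta x t := by
  unfold theta
  exact Measurable.tsum fun n => by fun_prop

lemma integral_one_dim (c : ℝ) {t : ℝ} (ht : 0 < t) :
    ∫ z : ℝ, Real.exp (-z ^ 2) / theta (√t * z + c) t =
      π ^ ((1 : ℝ) / 2) * ∫ x in Set.Icc (-(1 : ℝ) / 2) (1 / 2), theta x (t / 2) / theta (x + c) t := by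
  have hst : 0 < √t := Real.sqrt_pos.2 ht
  obtain ⟨b, hb, hlb⟩ := theta_lb ht
  let P : ℝ → ℝ := fun x => (2 * π * (t / 2)) ^ (-(1 : ℝ) / 2) * Real.exp (-x ^ 2 / (2 * (t / 2)))
  let F : ℝ → ℝ := fun x => P x / theta (x + c) t
  have hF0 : ∀ x, 0 ≤ F x := fun x => div_nonneg (by positivity) (theta_pos _ ht).le
  have hP : Integrable P := by
    apply Integrable.const_mul
    have := integrable_exp_neg_mul_sq (b := 1 / t) (by positivity)
    refine this.congr (Eventually.of_forall fun x => ?_)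
    simp only
    congr 1
    field_simp
  have hF : Integrable F := by
    have hm : Measurable fun x => theta (x + c) t := (measurable_theta t).comp (by fun_prop)
    have hPm : Measurable P := by fun_prop
    refine (hP.mul_const b⁻¹).mono' (hPm.div hm).aestronglyMeasurable
      (Eventually.of_forall fun x => ?_)
    rw [Real.norm_of_nonneg (hF0 x), ← div_eq_mul_inv]
    have : 0 ≤ P x := by positivity
    exact div_le_div_of_nonneg_left this hb (hlb _)
  have h1 : ∫ z : ℝ, Real.exp (-z ^ 2) / theta (√t * z + c) t = π ^ ((1 : ℝ) / 2) * ∫ x, F x := by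
    have h := Measure.integral_comp_mul_left (fun x => Real.exp (-x^2/t) / theta (x + c) t) (√t)
    have e1 : ∀ z, Real.exp (-(√t * z)^2/t) = Real.exp (-z^2) := fun z => by
      congr 1
      rw [mul_pow, Real.sq_sqrt ht.le]
      field_simp
    simp only [e1] at h
    rw [h, smul_eq_mul, abs_of_pos (inv_pos.2 hst), ← integral_const_mul, ← integral_const_mul]
    congr 1
    funext x
    simp only [F, P]
    have e2 : 2 * π * (t/2) = π * t := by ring
    have e3 : 2 * (t/2) = t := by ring
    rw [e2, e3, neg_div 2 (1:ℝ), Real.rpow_neg (by positivity), Real.mul_rpow pi_pos.le ht.le,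
      ← Real.sqrt_eq_rpow, ← Real.sqrt_eq_rpow]
    have : 0 < √π := Real.sqrt_pos.2 pi_pos
    field_simp
  rw [h1]
  congr 1
  have hs := hF.hasSum_intervalIntegral_comp_add_int
  simp only [intervalIntegral.integral_of_le zero_le_one] at hs
  have hs2 := hasSum_integral_of_summable_integral_norm
    (μ := volume.restrict (Set.Ioc (0:ℝ) 1)) (F := fun (n : ℤ) x => F (x + n))
    (fun n => (hF.comp_add_right (n:ℝ)).restrict)
    (by simpa only [Real.norm_of_nonneg (hF0 _)] using hs.summable)
  rw [hs.unique hs2]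
  have hper : Function.Periodic (fun x => theta x (t / 2) / theta (x + c) t) 1 := by
    intro x
    have a := theta_add_int x (t/2) 1
    have b := theta_add_int (x + c) t 1
    push_cast at a b
    simp only [a, add_right_comm x 1 c, b]
  have h4 := hper.intervalIntegral_add_eq 0 (-(1:ℝ)/2)
  have e5 : -(1:ℝ)/2 + 1 = 1/2 := by norm_num
  rw [zero_add, e5, intervalIntegral.integral_of_le zero_le_one,
    intervalIntegral.integral_of_le (by norm_num), ← integral_Icc_eq_integral_Ioc (x := -(1:ℝ)/2)] at h4
  rw [← h4]
  congr 1
  funext x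
  have e6 : ∀ n : ℤ, F (x + n) = P (x + n) * (theta (x + c) t)⁻¹ := fun n => by
    simp only [F, add_right_comm x (n:ℝ) c, theta_add_int, div_eq_mul_inv]
  simp only [e6, tsum_mul_right]
  rw [div_eq_mul_inv]
  congr 1
  unfold theta
  rw [← (Equiv.neg ℤ).tsum_eq]
  simp [P, sub_eq_add_neg]

lemma pHeatK_eq (d : ℕ) {t : ℝ} (ht : 0 < t) (x : EuclideanSpace ℝ (Fin d)) :
    pHeatK d t x = ∏ i, theta (x i) t := by
  unfold theta
  rw [← (hasSum_pi_prod_aux d _ (fun i n => by positivity)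
    (fun i => summable_theta_aux (x i) ht)).tsum_eq]
  unfold pHeatK
  refine tsum_congr fun n => ?_
  unfold heatK
  rw [Finset.prod_mul_distrib, ← Real.exp_sum, Finset.prod_const, Finset.card_univ, Fintype.card_fin,
    ← Real.rpow_mul_natCast (by positivity), EuclideanSpace.norm_sq_eq, ← Finset.sum_div]
  congr 2
  · ring
  · simp [latVec]

lemma q_parity (k : ℤ) (t : ℝ) :
    (∫ x in Set.Icc (-(1 : ℝ) / 2) (1 / 2), theta x (t / 2) / theta (x + (2:ℝ)⁻¹ * k) t)
      = if Even k then qfun 0 t else qfun 1 t := by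
  split_ifs with h
  · obtain ⟨r, rfl⟩ := h
    unfold qfun
    congr 1
    funext x
    have : x + (2:ℝ)⁻¹ * ((r + r : ℤ) : ℝ) = x + 0 / 2 + (r : ℤ) := by push_cast; ring
    rw [this, theta_add_int]
  · obtain ⟨r, rfl⟩ := Int.not_even_iff_odd.1 h
    unfold qfun
    congr 1
    funext x
    have : x + (2:ℝ)⁻¹ * ((2 * r + 1 : ℤ) : ℝ) = x + 1 / 2 + (r : ℤ) := by push_cast; ring
    rw [this, theta_add_int]

lemma inner_eq (d : ℕ) (m : ZLat d) {t : ℝ} (ht : 0 < t) :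
    ∫ z : EuclideanSpace ℝ (Fin d), Real.exp (-‖z‖ ^ 2) / pHeatK d t (√t • z + (2 : ℝ)⁻¹ • latVec m)
      = π ^ ((d : ℝ) / 2) * (qfun 0 t ^ evenCount m * qfun 1 t ^ (d - evenCount m)) := by
  rw [← (PiLp.volume_preserving_toLp (Fin d)).integral_comp
    (MeasurableEquiv.toLp 2 (Fin d → ℝ)).measurableEmbedding]
  have : ∀ z : Fin d → ℝ, Real.exp (-‖WithLp.toLp 2 z‖ ^ 2) /
      pHeatK d t (√t • WithLp.toLp 2 z + (2 : ℝ)⁻¹ • latVec m)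
      = ∏ i, (Real.exp (-z i ^ 2) / theta (√t * z i + (2:ℝ)⁻¹ * m i) t) := fun z => by
    rw [pHeatK_eq d ht, Finset.prod_div_distrib, ← Real.exp_sum, EuclideanSpace.norm_sq_eq]
    simp [latVec]
  simp only [this]
  rw [integral_fintype_prod_volume_eq_prod
    (f := fun i (z : ℝ) => Real.exp (-z ^ 2) / theta (√t * z + (2:ℝ)⁻¹ * m i) t)]
  simp only [integral_one_dim _ ht, q_parity]
  rw [Finset.prod_mul_distrib, Finset.prod_const, Finset.card_univ, Fintype.card_fin,
    ← Real.rpow_mul_natCast pi_pos.le]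
  classical
  rw [Finset.prod_ite, Finset.prod_const, Finset.prod_const]
  have hc := Finset.card_filter_add_card_filter_not (s := (Finset.univ : Finset (Fin d)))
    (fun i => Even (m i))
  rw [Finset.card_univ, Fintype.card_fin] at hc
  have he : evenCount m = (Finset.univ.filter fun i => Even (m i)).card := by
    unfold evenCount; congr
  rw [he, ← Nat.eq_sub_of_add_eq' hc]
  congr 2
  ring

lemma main_eq (d : ℕ) (m : ZLat d) (hm : m ≠ 0) :
    Ufun d (latVec m) =
      -(Real.Gamma (((d : ℝ) + 2) / 2))⁻¹ *
        ∫ t in Set.Ioi (0 : ℝ), t ^ ((d : ℝ) / 2) * Real.exp (-t) *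
          qfun 0 (‖latVec m‖ ^ 2 / (4 * t)) ^ evenCount m *
          qfun 1 (‖latVec m‖ ^ 2 / (4 * t)) ^ (d - evenCount m) := by
  have hn : 0 < ‖latVec m‖ := by
    rw [norm_pos_iff]
    intro h
    apply hm
    funext i
    have := congrArg (fun v : EuclideanSpace ℝ (Fin d) => v i) h
    simpa [latVec] using this
  unfold Ufun
  have key : ∀ s ∈ Set.Ioi (0:ℝ), (∫ z : EuclideanSpace ℝ (Fin d),
      s ^ ((d : ℝ) / 2) * Real.exp (-s - ‖z‖ ^ 2) /
        pHeatK d (‖latVec m‖ ^ 2 / (4 * s)) ((‖latVec m‖ / (2 * Real.sqrt s)) • z + (2 : ℝ)⁻¹ • latVec m))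
      = π ^ ((d : ℝ) / 2) * (s ^ ((d : ℝ) / 2) * Real.exp (-s) *
          qfun 0 (‖latVec m‖ ^ 2 / (4 * s)) ^ evenCount m *
          qfun 1 (‖latVec m‖ ^ 2 / (4 * s)) ^ (d - evenCount m)) := by
    intro s hs
    have hs : 0 < s := hs
    have ht : 0 < ‖latVec m‖ ^ 2 / (4 * s) := by positivity
    have hsq : ‖latVec m‖ / (2 * Real.sqrt s) = √(‖latVec m‖ ^ 2 / (4 * s)) := by
      rw [Real.sqrt_div (by positivity), Real.sqrt_sq hn.le, Real.sqrt_mul (by norm_num)]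
      congr 2
      rw [show (4:ℝ) = 2 ^ 2 by norm_num, Real.sqrt_sq (by norm_num)]
    have := inner_eq d m ht
    rw [← hsq] at this
    calc _ = ∫ z : EuclideanSpace ℝ (Fin d), (s ^ ((d : ℝ) / 2) * Real.exp (-s)) *
          (Real.exp (-‖z‖ ^ 2) / pHeatK d (‖latVec m‖ ^ 2 / (4 * s))
            ((‖latVec m‖ / (2 * Real.sqrt s)) • z + (2 : ℝ)⁻¹ • latVec m)) := by
          congr 1
          funext z
          rw [sub_eq_add_neg, Real.exp_add]
          ring
      _ = _ := by
          rw [integral_const_mul, this]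
          ring
  rw [setIntegral_congr_fun measurableSet_Ioi key, integral_const_mul]
  have : π ^ ((d : ℝ) / 2) ≠ 0 := by positivity
  rw [mul_inv, ← mul_assoc]
  congr 1
  field_simp

theorem stmt10 (d : ℕ) (hd : 2 ≤ d) (m : ZLat d) (hm : m ≠ 0) :
    (Ufun d (latVec m) =
      -(Real.Gamma (((d : ℝ) + 2) / 2))⁻¹ *
        ∫ t in Set.Ioi (0 : ℝ), t ^ ((d : ℝ) / 2) * Real.exp (-t) *
          qfun 0 (‖latVec m‖ ^ 2 / (4 * t)) ^ evenCount m *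
          qfun 1 (‖latVec m‖ ^ 2 / (4 * t)) ^ (d - evenCount m)) ∧
    ∀ m' : ZLat d, m' ≠ 0 → ‖latVec m'‖ = ‖latVec m‖ → evenCount m' = evenCount m →
      Ufun d (latVec m') = Ufun d (latVec m) := by
  refine ⟨main_eq d m hm, fun m' hm' h1 h2 => ?_⟩
  rw [main_eq d m hm, main_eq d m' hm', h1, h2]

end
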